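/- Main theorem (special case): let f_1, ..., f_n ∈ F[x] be polynomials over F = F_q((T⁻¹)) such that 1, f_1, ..., f_n are linearly independent over F, let U ⊆ F be open, and set f(x) = (f_1(x), ..., f_n(x)). Then there exists ε_0 > 0 such that for every ε < ε_0, the vector f(x) is not Dirichlet ε-improvable for Haar-almost every x ∈ U. -/

import Mathlib

open scoped Classical in
/-- The absolute value `|a| = e^(deg a)` on `F = F_q((T⁻¹))`.  We realize `F` as the
field of Laurent series `F_q((X))` via `X = T⁻¹`, so that `deg a = −(order a)`. -/
noncomputable def lAbs {Fq : Type*} [Field Fq] (a : LaurentSeries Fq) : ℝ :=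
  if a = 0 then 0 else Real.exp (-(a.order : ℝ))

/-- The element `T ∈ F = F_q((T⁻¹))` (i.e. `X⁻¹` in the Laurent series realization). -/
noncomputable def Tvar (Fq : Type*) [Field Fq] : LaurentSeries Fq :=
  HahnSeries.single (-1 : ℤ) 1

/-- The embedding of `Λ = F_q[T]` into `F = F_q((T⁻¹))`, sending a polynomial `p` to `p(T)`. -/
noncomputable def polyToF {Fq : Type*} [Field Fq] (p : Polynomial Fq) : LaurentSeries Fq :=
  Polynomial.aeval (Tvar Fq) p

open MeasureTheory

/-- `y ∈ F^n` is Dirichlet `ε`-improvable: there is `t₀` such that for all nonnegative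
integers `t₁, ..., t_n` with `max(t, t₁, ..., t_n) > t₀` (where `t = t₁ + ... + t_n`)
there is a nonzero `(p, q) ∈ Λ × Λ^n` with `|y·q − p| < ε e^(−t)` and
`|q_j| < ε e^(t_j)` for all `j`. -/
def DirichletImprovable {Fq : Type*} [Field Fq] (n : ℕ)
    (y : Fin n → LaurentSeries Fq) (ε : ℝ) : Prop :=
  ∃ t₀ : ℕ, ∀ t : Fin n → ℕ, t₀ < max (∑ j, t j) (Finset.univ.sup t) →
    ∃ (p : Polynomial Fq) (q : Fin n → Polynomial Fq), (p, q) ≠ 0 ∧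
      lAbs (∑ j, y j * polyToF (q j) - polyToF p) < ε * Real.exp (-(∑ j, t j : ℝ)) ∧
      ∀ j, lAbs (polyToF (q j)) < ε * Real.exp (t j : ℝ)

section AbsoluteValue

variable {Fq : Type*} [Field Fq]

lemma lAbs_zero : lAbs (0 : LaurentSeries Fq) = 0 := by
  simp [lAbs]

lemma lAbs_of_ne_zero {a : LaurentSeries Fq} (ha : a ≠ 0) :
    lAbs a = Real.exp (-(a.order : ℝ)) := by
  simp [lAbs, ha]

lemma lAbs_nonneg (a : LaurentSeries Fq) : 0 ≤ lAbs a := by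
  unfold lAbs
  split_ifs <;> positivity

lemma lAbs_pos {a : LaurentSeries Fq} (ha : a ≠ 0) : 0 < lAbs a := by
  rw [lAbs_of_ne_zero ha]
  positivity

lemma lAbs_mul (a b : LaurentSeries Fq) : lAbs (a * b) = lAbs a * lAbs b := by
  by_cases ha : a = 0
  · simp [ha, lAbs_zero]
  by_cases hb : b = 0
  · simp [hb, lAbs_zero]
  rw [lAbs_of_ne_zero ha, lAbs_of_ne_zero hb, lAbs_of_ne_zero (mul_ne_zero ha hb),
    HahnSeries.order_mul ha hb, ← Real.exp_add]
  push_cast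
  ring_nf

lemma lAbs_add_le_max (a b : LaurentSeries Fq) : lAbs (a + b) ≤ max (lAbs a) (lAbs b) := by
  by_cases ha : a = 0
  · simp [ha]
  by_cases hb : b = 0
  · simp [hb]
  by_cases hab : a + b = 0
  · rw [hab, lAbs_zero]
    exact le_max_of_le_left (lAbs_nonneg a)
  rw [lAbs_of_ne_zero ha, lAbs_of_ne_zero hb, lAbs_of_ne_zero hab]
  simp only [le_max_iff, Real.exp_le_exp, neg_le_neg_iff, Int.cast_le]
  exact min_le_iff.1 (HahnSeries.min_order_le_order_add hab)

lemma polyToF_coeff_neg (p : Polynomial Fq) (k : ℕ) :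
    (polyToF p).coeff (-(k : ℤ)) = p.coeff k := by
  have hT (i : ℕ) : Tvar Fq ^ i = HahnSeries.single (-(i : ℤ)) 1 := by
    simp [Tvar, HahnSeries.single_pow]
  rw [polyToF]
  induction p using Polynomial.induction_on' with
  | add p q hp hq => simp [hp, hq]
  | monomial i a =>
    rw [Polynomial.aeval_monomial, hT, LaurentSeries.algebraMap_apply, HahnSeries.C_apply,
      HahnSeries.single_mul_single, zero_add, mul_one, HahnSeries.coeff_single, Polynomial.coeff_monomial]
    by_cases h : i = k
    · simp [h]
    · have : -(k : ℤ) ≠ -(i : ℤ) := by omega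
      simp [h, this]

lemma polyToF_injective : Function.Injective (polyToF : Polynomial Fq → LaurentSeries Fq) := by
  intro p q h
  ext k
  rw [← polyToF_coeff_neg, h, polyToF_coeff_neg]

lemma polyToF_ne_zero {p : Polynomial Fq} (hp : p ≠ 0) : polyToF p ≠ 0 :=
  fun h => hp (polyToF_injective (h.trans (by simp [polyToF])))

lemma one_le_lAbs_polyToF {p : Polynomial Fq} (hp : p ≠ 0) : 1 ≤ lAbs (polyToF p) := by
  obtain ⟨k, hk⟩ : ∃ k, p.coeff k ≠ 0 := by
    by_contra! h
    exact hp (Polynomial.ext (by simpa using h))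
  have h : (polyToF p).order ≤ -(k : ℤ) :=
    HahnSeries.order_le_of_coeff_ne_zero (by rwa [polyToF_coeff_neg])
  rw [lAbs_of_ne_zero (polyToF_ne_zero hp), Real.one_le_exp_iff, ← Int.cast_neg]
  exact_mod_cast (by omega : (0 : ℤ) ≤ -(polyToF p).order)

lemma eq_zero_of_lAbs_polyToF_lt_one {p : Polynomial Fq} (hp : lAbs (polyToF p) < 1) : p = 0 := by
  by_contra h
  exact absurd (one_le_lAbs_polyToF h) hp.not_ge

end AbsoluteValue

section Improvable

variable {Fq : Type*} [Field Fq]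

/-- An approximation `p / q` of an irrational `y` at scale `m` can be replaced by one at the same
scale with a smaller denominator, provided approximations exist at all larger scales. -/
lemma exists_smaller_denominator {y : LaurentSeries Fq}
    (hy : ∀ p q : Polynomial Fq, q ≠ 0 → y * polyToF q - polyToF p ≠ 0) {m : ℕ}
    (H : ∀ s : ℕ, m ≤ s → ∃ p q : Polynomial Fq, q ≠ 0 ∧
      lAbs (y * polyToF q - polyToF p) < Real.exp (-(s : ℝ)) ∧
      lAbs (polyToF q) < Real.exp (s : ℝ))
    {p q : Polynomial Fq} (hq : q ≠ 0)
    (h₁ : lAbs (y * polyToF q - polyToF p) < Real.exp (-(m : ℝ)))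
    (h₂ : lAbs (polyToF q) < Real.exp (m : ℝ)) :
    ∃ p' q' : Polynomial Fq, q' ≠ 0 ∧
      lAbs (y * polyToF q' - polyToF p') < Real.exp (-(m : ℝ)) ∧
      lAbs (polyToF q') < lAbs (polyToF q) := by
  have hd := hy p q hq
  have hord : (m : ℤ) < (y * polyToF q - polyToF p).order := by
    rw [lAbs_of_ne_zero hd, Real.exp_lt_exp, neg_lt_neg_iff] at h₁
    exact_mod_cast h₁
  obtain ⟨s, hs⟩ := Int.eq_ofNat_of_zero_le (by omega : 0 ≤ (y * polyToF q - polyToF p).order)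
  have hms : m < s := by omega
  have hds : lAbs (y * polyToF q - polyToF p) = Real.exp (-(s : ℝ)) := by
    rw [lAbs_of_ne_zero hd, hs]
    simp
  obtain ⟨p', q', hq', h₁', h₂'⟩ := H s hms.le
  have hms' : Real.exp (-(s : ℝ)) < Real.exp (-(m : ℝ)) := by
    simpa using hms
  refine ⟨p', q', hq', h₁'.trans hms', ?_⟩
  have hA : lAbs (polyToF q * (y * polyToF q' - polyToF p')) < 1 := by
    rw [lAbs_mul]
    calc _ < Real.exp m * Real.exp (-(m : ℝ)) :=
          mul_lt_mul'' h₂ (h₁'.trans hms') (lAbs_nonneg _) (lAbs_nonneg _)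
      _ = 1 := by rw [← Real.exp_add]; simp
  have hB : lAbs (-polyToF q' * (y * polyToF q - polyToF p)) < 1 := by
    have hneg : lAbs (-polyToF q') = lAbs (polyToF q') := by
      
      have h₀ := polyToF_ne_zero hq'
      rw [lAbs_of_ne_zero (neg_ne_zero.2 h₀), lAbs_of_ne_zero h₀, HahnSeries.order_neg]
    rw [lAbs_mul, hds, hneg]
    calc _ < Real.exp s * Real.exp (-(s : ℝ)) := by gcongr
      _ = 1 := by rw [← Real.exp_add]; simp
  have hdet : q' * p - q * p' = 0 := by
    apply eq_zero_of_lAbs_polyToF_lt_one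
    have heq : polyToF (q' * p - q * p') = polyToF q * (y * polyToF q' - polyToF p') +
        -polyToF q' * (y * polyToF q - polyToF p) := by
      simp only [polyToF, map_sub, map_mul]
      ring
    rw [heq]
    exact (lAbs_add_le_max _ _).trans_lt (max_lt hA hB)
  have hcross : polyToF q * (y * polyToF q' - polyToF p') =
      polyToF q' * (y * polyToF q - polyToF p) := by
    have h := congrArg polyToF hdet
    simp only [polyToF, map_sub, map_mul, map_zero] at h ⊢
    linear_combination h
  have habs := congrArg lAbs hcross
  rw [lAbs_mul, lAbs_mul, hds] at habs
  have hlt : lAbs (polyToF q') * Real.exp (-(s : ℝ)) <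
      lAbs (polyToF q) * Real.exp (-(s : ℝ)) := by
    rw [← habs]
    exact mul_lt_mul_of_pos_left h₁' (lAbs_pos (polyToF_ne_zero hq))
  exact lt_of_mul_lt_mul_right hlt (Real.exp_pos _).le

/-- In one dimension, no irrational Laurent series improves on Dirichlet's theorem. -/
lemma exists_rational_of_forall_approximable {y : LaurentSeries Fq} {m : ℕ}
    (H : ∀ s : ℕ, m ≤ s → ∃ p q : Polynomial Fq, q ≠ 0 ∧
      lAbs (y * polyToF q - polyToF p) < Real.exp (-(s : ℝ)) ∧
      lAbs (polyToF q) < Real.exp (s : ℝ)) :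
    ∃ p q : Polynomial Fq, q ≠ 0 ∧ y * polyToF q - polyToF p = 0 := by
  by_contra! hy
  have descent (d : ℕ) : ∀ p q : Polynomial Fq, q ≠ 0 →
      (-(polyToF q).order).toNat = d →
      lAbs (y * polyToF q - polyToF p) < Real.exp (-(m : ℝ)) →
      lAbs (polyToF q) < Real.exp (m : ℝ) → False := by
    induction d using Nat.strong_induction_on with
    | _ d ih =>
      intro p q hq hd h₁ h₂
      obtain ⟨p', q', hq', h₁', hlt⟩ := exists_smaller_denominator hy H hq h₁ h₂
      refine ih _ ?_ p' q' hq' rfl h₁' (hlt.trans h₂)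
      have hone := one_le_lAbs_polyToF hq'
      rw [lAbs_of_ne_zero (polyToF_ne_zero hq'), Real.one_le_exp_iff] at hone
      rw [lAbs_of_ne_zero (polyToF_ne_zero hq'), lAbs_of_ne_zero (polyToF_ne_zero hq),
        Real.exp_lt_exp] at hlt
      have hone' : 0 ≤ -(polyToF q').order := by exact_mod_cast hone
      have hlt' : -(polyToF q').order < -(polyToF q).order := by exact_mod_cast hlt
      omega
  obtain ⟨p, q, hq, h₁, h₂⟩ := H m le_rfl
  exact descent _ p q hq rfl h₁ h₂

lemma DirichletImprovable.exists_rational {n : ℕ} {y : Fin n → LaurentSeries Fq} {ε : ℝ}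
    (hε : ε ≤ 1) (h : DirichletImprovable n y ε) (i : Fin n) :
    ∃ p q : Polynomial Fq, q ≠ 0 ∧ y i * polyToF q - polyToF p = 0 := by
  obtain ⟨t₀, h⟩ := h
  refine exists_rational_of_forall_approximable (m := t₀ + 1) fun s hs => ?_
  have hsum : ∑ j, (Pi.single i s : Fin n → ℕ) j = s := by simp
  obtain ⟨p, q, hpq, h₁, h₂⟩ := h (Pi.single i s) (lt_max_of_lt_left (by rw [hsum]; omega))
  have hz (j : Fin n) (hj : j ≠ i) : q j = 0 := by
    apply eq_zero_of_lAbs_polyToF_lt_one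
    have := h₂ j
    simp only [Pi.single_eq_of_ne hj, Nat.cast_zero, Real.exp_zero, mul_one] at this
    exact this.trans_le hε
  have hlin : ∑ j, y j * polyToF (q j) = y i * polyToF (q i) :=
    Finset.sum_eq_single i (fun j _ hj => by simp [hz j hj, polyToF]) (by simp)
  have hle (x : ℝ) : ε * Real.exp x ≤ Real.exp x :=
    mul_le_of_le_one_left (Real.exp_pos x).le hε
  rw [hlin, ← Nat.cast_sum, hsum] at h₁
  have h₂i := h₂ i
  rw [Pi.single_eq_same] at h₂i
  refine ⟨p, q i, fun hqi => hpq ?_, h₁.trans_le (hle _), h₂i.trans_le (hle _)⟩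
  have hp : lAbs (polyToF (-p)) < 1 := by
    have h₃ := h₁.trans_le (hle _)
    have h₄ : y i * polyToF (q i) - polyToF p = polyToF (-p) := by simp [hqi, polyToF]
    rw [h₄] at h₃
    exact h₃.trans_le (by simp)
  have hq : q = 0 := funext fun j => by
    by_cases hj : j = i
    · rw [hj, hqi, Pi.zero_apply]
    · exact hz j hj
  simpa [hq] using eq_zero_of_lAbs_polyToF_lt_one hp

end Improvable

section Haar

open Filter Topology

lemma tendsto_laurentSeries_single_atTop (K : Type*) [Field K] :
    Tendsto (fun k : ℕ => (HahnSeries.single (k : ℤ) 1 : LaurentSeries K)) atTop (𝓝 0) := by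
  intro s hs
  obtain ⟨γ, hγ⟩ := Valued.mem_nhds_zero.1 hs
  set δ := MonoidWithZeroHom.ValueGroup₀.embedding γ.1 with hδ
  have hδ0 : δ ≠ 0 := by simp [hδ]
  rw [mem_map]
  filter_upwards [eventually_gt_atTop (-WithZero.log δ).toNat] with k hk
  apply hγ
  rw [Set.mem_ofPred_eq, Valuation.restrict_lt_iff_lt_embedding, ← hδ,
    LaurentSeries.valuation_single_zpow, ← WithZero.exp_log hδ0, WithZero.exp_lt_exp]
  omega

lemma haar_singleton_laurentSeries {K : Type*} [Field K]
    [MeasurableSpace (LaurentSeries K)] [BorelSpace (LaurentSeries K)]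
    (μ : Measure (LaurentSeries K)) [μ.IsAddHaarMeasure] (x : LaurentSeries K) : μ {x} = 0 := by
  by_contra hx
  have hcpt := (tendsto_laurentSeries_single_atTop K).isCompact_insert_range
  have hinj : Function.Injective
      (fun k : ℕ => (HahnSeries.single (k : ℤ) 1 : LaurentSeries K)) := by
    intro a b hab
    have h := congrArg HahnSeries.order hab
    simpa [HahnSeries.order_single (one_ne_zero : (1 : K) ≠ 0)] using h
  have hinf := (Set.infinite_range_of_injective hinj).mono (Set.subset_insert 0 _)
  refine (hcpt.measure_lt_top (μ := μ)).ne (hinf.meas_eq_top ⟨μ {x}, hx, fun z _ => ?_⟩)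
  rw [Measure.addHaar_singleton μ z, Measure.addHaar_singleton μ x]

end Haar

/-- The points where a nonconstant polynomial takes values in `F_q(T)` form a countable set. -/
lemma countable_setOf_eval_rational {Fq : Type*} [Field Fq] [Finite Fq]
    {g : Polynomial (LaurentSeries Fq)} (hg : ∀ c, g ≠ Polynomial.C c) :
    {x | ∃ p q : Polynomial Fq, q ≠ 0 ∧ g.eval x * polyToF q - polyToF p = 0}.Countable := by
  have : Countable (Polynomial Fq) :=
    Cardinal.mk_le_aleph0_iff.1 (Polynomial.cardinalMk_le_max.trans (by simp))
  refine (Set.countable_iUnion fun pq : Polynomial Fq × Polynomial Fq =>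
    ((g - Polynomial.C (polyToF pq.1 / polyToF pq.2)).rootSet_finite
      (LaurentSeries Fq)).countable).mono ?_
  rintro x ⟨p, q, hq, h⟩
  refine Set.mem_iUnion.2 ⟨(p, q), ?_⟩
  rw [Polynomial.mem_rootSet]
  refine ⟨sub_ne_zero.2 (hg _), ?_⟩
  have := polyToF_ne_zero hq
  simp only [Polynomial.coe_aeval_eq_eval, Polynomial.eval_sub, Polynomial.eval_C]
  rw [sub_eq_zero, eq_div_iff this]
  exact sub_eq_zero.1 h

/-- main theorem, special case: if `f₁, ..., f_n ∈ F[x]` are polynomials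
over `F = F_q((T⁻¹))` such that `1, f₁, ..., f_n` are linearly independent over `F`, and
`U ⊆ F` is open, then there is `ε₀ > 0` such that for every `0 < ε < ε₀` the vector
`(f₁(x), ..., f_n(x))` is not Dirichlet `ε`-improvable for Haar-almost every `x ∈ U`. -/
theorem main_theorem_special_case {Fq : Type*} [Field Fq] [Fintype Fq]
    [MeasurableSpace (LaurentSeries Fq)] [BorelSpace (LaurentSeries Fq)]
    (lam : Measure (LaurentSeries Fq)) [lam.IsAddHaarMeasure]
    (n : ℕ) (hn : 0 < n) (f : Fin n → Polynomial (LaurentSeries Fq))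
    (hli : LinearIndependent (LaurentSeries Fq)
      (Fin.cons 1 f : Fin (n + 1) → Polynomial (LaurentSeries Fq)))
    (U : Set (LaurentSeries Fq)) (hU : IsOpen U) :
    ∃ ε₀ > (0 : ℝ), ∀ ε : ℝ, 0 < ε → ε < ε₀ →
      ∀ᵐ x ∂lam, x ∈ U →
        ¬ DirichletImprovable n (fun j => (f j).eval x) ε := by
  refine ⟨1, one_pos, fun ε _ hε => ?_⟩
  have hg (c : LaurentSeries Fq) : f ⟨0, hn⟩ ≠ Polynomial.C c := by
    intro h
    have hpair := hli.comp ![0, Fin.succ ⟨0, hn⟩] (by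
      intro a b
      fin_cases a <;> fin_cases b <;> simp)
    have hrel := (Fintype.linearIndependent_iff.1 hpair) ![-c, 1] (by
      simp only [Fin.sum_univ_two, Function.comp_apply, Matrix.cons_val_zero,
        Matrix.cons_val_one, Fin.cons_zero, Fin.cons_succ, h, Polynomial.smul_eq_C_mul]
      simp) 1
    simp at hrel
  have hnull : lam {x | ∃ p q : Polynomial Fq, q ≠ 0 ∧
      (f ⟨0, hn⟩).eval x * polyToF q - polyToF p = 0} = 0 := by
    have hcount := countable_setOf_eval_rational hg
    rw [← Set.biUnion_of_singleton {x | _}, measure_biUnion_null_iff hcount]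
    exact fun x _ => haar_singleton_laurentSeries lam x
  filter_upwards [measure_eq_zero_iff_ae_notMem.1 hnull] with x hx _ himp
  exact hx (himp.exists_rational hε.le ⟨0, hn⟩)
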